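/- Let n be a nonnegative integer and let a, b, c ∈ ℂ with b ≠ 1/2. Set w = (c+bn)/(1−2b), and assume c+bn ≠ 0, c+a ≠ 0, c−a ≠ 0, c + j ≠ 0 for 0 ≤ j ≤ max(n−1, ⌊n/2⌋), w + j ≠ 0 for 0 ≤ j ≤ ⌊n/2⌋−1, and 1−c−n+j ≠ 0 for 0 ≤ j ≤ ⌊n/2⌋−1. Then Σ_{k=0}^{⌊n/2⌋} (−n/2)_k ((1−n)/2)_k (1+w)_k (−a)_k (a)_k / ((1/2)_k (w)_k (c+1)_k (1−c−n)_k · k!) = (c(c+a+bn)/(2(c+bn)(a+c))) · (c+a)_n/(c)_n + (c(c−a+bn)/(2(c+bn)(c−a))) · (c−a)_n/(c)_n. (Terminating balanced series identity with free parameter b; the left-hand side is ₅F₄[−n/2, (1−n)/2, 1+(c+bn)/(1−2b), −a, a; 1/2, (c+bn)/(1−2b), c+1, 1−c−n; 1].) -/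

import Mathlib

/-- Rising factorial (Pochhammer symbol) of a complex number:
`poch x 0 = 1` and `poch x (m+1) = poch x m * (x + m)`. -/
noncomputable def poch (x : ℂ) : ℕ → ℂ
  | 0 => 1
  | m + 1 => poch x m * (x + (m : ℂ))

noncomputable def cfac (a : ℂ) : ℕ → ℂ
  | 0 => 1
  | k + 1 => cfac a k * (a ^ 2 - (k : ℂ) ^ 2)

noncomputable def tm (c : ℂ) (n k : ℕ) : ℂ := (n.choose (2 * k) : ℂ) * poch (c + k) (n - 2 * k)

lemma poch_left (x : ℂ) (m : ℕ) : poch x (m + 1) = x * poch (x + 1) m := by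
  induction m with
  | zero => simp [poch]
  | succ m ih =>
    rw [poch, ih, poch]; push_cast; ring

lemma poch_add' (x : ℂ) (i j : ℕ) : poch x (i + j) = poch x i * poch (x + i) j := by
  induction j with
  | zero => simp [poch]
  | succ j ih =>
    rw [← Nat.add_assoc, poch, ih, poch]; push_cast; ring

lemma poch_ne (x : ℂ) (m : ℕ) (h : ∀ j : ℕ, j < m → x + (j : ℂ) ≠ 0) : poch x m ≠ 0 := by
  induction m with
  | zero => simp [poch]
  | succ m ih =>
    rw [poch]
    exact mul_ne_zero (ih fun j hj => h j (by omega)) (h m (by omega))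

lemma cfac_eq (a : ℂ) (k : ℕ) : poch (-a) k * poch a k = (-1) ^ k * cfac a k := by
  induction k with
  | zero => simp [poch, cfac]
  | succ k ih =>
    rw [poch, poch, cfac, pow_succ]
    linear_combination (-a + k) * (a + k) * ih

lemma choose_step (n j : ℕ) :
    (n.choose (j + 1) : ℂ) * (j + 1) = n.choose j * ((n : ℂ) - j) := by
  have h := Nat.choose_succ_right_eq n j
  rcases le_or_gt j n with hj | hj
  · have := congrArg (Nat.cast : ℕ → ℂ) h
    push_cast [Nat.cast_sub hj] at this
    exact this
  · rw [Nat.choose_eq_zero_of_lt hj, Nat.choose_eq_zero_of_lt (by omega)]; simp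

lemma half_poch (n k : ℕ) : poch (-(n : ℂ) / 2) k * poch ((1 - (n : ℂ)) / 2) k =
    n.choose (2 * k) * (poch (1 / 2) k * (Nat.factorial k : ℂ)) := by
  induction k with
  | zero => simp [poch]
  | succ k ih =>
    have h1 := choose_step n (2 * k)
    have h2 := choose_step n (2 * k + 1)
    rw [poch, poch, poch, Nat.factorial_succ, show 2 * (k + 1) = 2 * k + 1 + 1 by ring]
    push_cast at h1 h2 ⊢
    linear_combination (-(n : ℂ) / 2 + k) * ((1 - (n : ℂ)) / 2 + k) * ih
      - (poch (1 / 2) k * (Nat.factorial k : ℂ)) / 4 *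
        ((2 * k + 1) * h2 + (n - (2 * k + 1)) * h1)

lemma poch_shift (w : ℂ) (k : ℕ) : poch (1 + w) k * w = poch w k * (w + k) := by
  have := poch_left w k
  rw [poch] at this
  rw [this, add_comm 1 w]; ring

lemma poch_refl (c : ℂ) (n k : ℕ) (hk : k ≤ n) :
    poch (1 - c - (n : ℂ)) k * (-1) ^ k * poch c (n - k) = poch c n := by
  induction k with
  | zero => simp [poch]
  | succ k ih =>
    have ih := ih (by omega)
    obtain ⟨m, rfl⟩ : ∃ m, n = m + (k + 1) := ⟨n - (k + 1), by omega⟩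
    rw [show m + (k + 1) - k = m + 1 by omega, poch] at ih
    rw [show m + (k + 1) - (k + 1) = m by omega, poch, pow_succ, ← ih]
    push_cast; ring

lemma tm_zero (c : ℂ) (n : ℕ) :
    tm c (n + 2) 0 = (2 * (c + n) + 1) * tm c (n + 1) 0 - (c + n) ^ 2 * tm c n 0 := by
  simp [tm, poch]; ring

lemma tm_big (c : ℂ) (n k : ℕ) (h : n < 2 * k) : tm c n k = 0 := by
  simp [tm, Nat.choose_eq_zero_of_lt h]

lemma tm_succ (c : ℂ) (n k : ℕ) :
    tm c (n + 2) (k + 1) = (2 * (c + n) + 1) * tm c (n + 1) (k + 1)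
      - ((c + n) ^ 2 - ((k : ℂ) + 1) ^ 2) * tm c n (k + 1) + tm c n k := by
  rcases lt_trichotomy n (2 * k) with h | h | h
  · rw [tm_big _ _ _ h, tm_big, tm_big, tm_big] <;> first | omega | ring
  · subst h
    rw [tm_big c (2 * k) (k + 1) (by omega), tm_big c (2 * k + 1) (k + 1) (by omega)]
    simp [tm, poch, mul_add]
  · rcases Nat.lt_or_ge n (2 * k + 2) with h' | h'
    · obtain rfl : n = 2 * k + 1 := by omega
      rw [tm_big c (2 * k + 1) (k + 1) (by omega)]
      simp only [tm, mul_add, mul_one, show 2 * k + 1 + 2 = (2 * k + 2) + 1 by ring,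
        Nat.choose_succ_self_right, Nat.add_sub_cancel_left, Nat.choose_self,
        show 2 * k + 1 + 1 = 2 * k + 2 by ring, Nat.sub_self, poch]
      push_cast; ring
    · obtain ⟨m, rfl⟩ : ∃ m, n = 2 * k + 2 + m := ⟨n - (2 * k + 2), by omega⟩
      have h1 := choose_step (2 * k + 2 + m) (2 * k)
      have e1 : (2 * k + 2 + m + 2).choose (2 * k + 2) = (2 * k + 2 + m).choose (2 * k)
        + 2 * (2 * k + 2 + m).choose (2 * k + 1) + (2 * k + 2 + m).choose (2 * k + 2) := by
        rw [Nat.choose_succ_succ, Nat.choose_succ_succ, Nat.choose_succ_succ _ (2 * k + 1)]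
        ring
      have e2 : (2 * k + 2 + m + 1).choose (2 * k + 2) = 
        (2 * k + 2 + m).choose (2 * k + 1) + (2 * k + 2 + m).choose (2 * k + 2) := by
        rw [Nat.choose_succ_succ]
      simp only [tm, show 2 * (k + 1) = 2 * k + 2 by ring, e1, e2,
        show 2 * k + 2 + m + 2 - (2 * k + 2) = m + 1 + 1 by omega,
        show 2 * k + 2 + m + 1 - (2 * k + 2) = m + 1 by omega,
        show 2 * k + 2 + m - (2 * k + 2) = m by omega,
        show 2 * k + 2 + m - 2 * k = m + 1 + 1 by omega]
      rw [poch_left (c + k) (m + 1)]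
      simp only [poch]
      push_cast at h1 ⊢
      rw [show c + (k : ℂ) + 1 = c + (k + 1) by ring]
      generalize poch (c + (k + 1)) m = X at *
      generalize ((2 * k + 2 + m).choose (2 * k) : ℂ) = D at *
      generalize ((2 * k + 2 + m).choose (2 * k + 1) : ℂ) = B at *
      generalize ((2 * k + 2 + m).choose (2 * k + 2) : ℂ) = A at *
      linear_combination (-X * (c + (k + 1) + m)) * h1

lemma sum_rec (a c : ℂ) (n N : ℕ) (hN : n < 2 * N) :
    ∑ k ∈ Finset.range (N + 1), cfac a k * tm c (n + 2) k =
      (2 * (c + n) + 1) * ∑ k ∈ Finset.range (N + 1), cfac a k * tm c (n + 1) k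
      - ((c + n) ^ 2 - a ^ 2) * ∑ k ∈ Finset.range (N + 1), cfac a k * tm c n k := by
  have h : ∀ M, ∑ k ∈ Finset.range (M + 1), cfac a k * tm c (n + 2) k =
      (2 * (c + n) + 1) * ∑ k ∈ Finset.range (M + 1), cfac a k * tm c (n + 1) k
      - ((c + n) ^ 2 - a ^ 2) * ∑ k ∈ Finset.range (M + 1), cfac a k * tm c n k
      - cfac a (M + 1) * tm c n M := by
    intro M
    induction M with
    | zero => simp [tm_zero, cfac]; ring
    | succ M ih =>
      rw [Finset.sum_range_succ, ih, tm_succ, Finset.sum_range_succ _ (M + 1),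
        Finset.sum_range_succ _ (M + 1)]
      rw [cfac.eq_2 a (M + 1)]
      push_cast
      ring
  rw [h N, tm_big c n N hN]; ring

lemma key (a c : ℂ) (n : ℕ) : ∀ N, n < 2 * N + 2 →
    ∑ k ∈ Finset.range (N + 1), cfac a k * tm c n k =
      (poch (c + a) n + poch (c - a) n) / 2 := by
  have ext : ∀ n N, n < 2 * N + 2 → ∑ k ∈ Finset.range (N + 1), cfac a k * tm c n k =
      ∑ k ∈ Finset.range (N + 1 + 1), cfac a k * tm c n k := by
    intro n N h
    rw [Finset.sum_range_succ _ (N + 1), tm_big c n (N + 1) (by omega)]; simp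
  induction n using Nat.strong_induction_on with
  | _ n ih =>
    intro N hN
    match n, ih, hN with
    | 0, _, _ =>
      rw [Finset.sum_range_succ']
      rw [Finset.sum_eq_zero (fun k _ => by rw [tm_big _ _ _ (by omega)]; simp)]
      simp [tm, poch, cfac]
    | 1, _, _ =>
      rw [Finset.sum_range_succ']
      rw [Finset.sum_eq_zero (fun k _ => by rw [tm_big _ _ _ (by omega)]; simp)]
      simp [tm, poch, cfac]
    | n + 2, ih, hN =>
      rw [sum_rec a c n N (by omega), ih (n + 1) (by omega) N (by omega),
        ih n (by omega) N (by omega)]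
      simp only [poch]; push_cast; ring

lemma tm_shift (c : ℂ) (m k : ℕ) (hk : 2 * k ≤ m + 1) :
    ((m : ℂ) + 1 - 2 * k) * tm c (m + 1) k = (c + k) * ((m + 1) * tm (c + 1) m k) := by
  rcases Nat.lt_or_ge m (2 * k) with h | h
  · rw [tm_big (c + 1) m k h]
    have : (m : ℂ) + 1 = 2 * k := by
      have : m + 1 = 2 * k := by omega
      exact_mod_cast this
    rw [this]; ring
  · obtain ⟨r, rfl⟩ : ∃ r, m = 2 * k + r := ⟨m - 2 * k, by omega⟩
    have h1 := congrArg (Nat.cast : ℕ → ℂ) (Nat.add_one_mul_choose_eq (2 * k + r) (2 * k))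
    have h2 := choose_step (2 * k + r + 1) (2 * k)
    simp only [tm, show 2 * k + r + 1 - 2 * k = r + 1 by omega,
      show 2 * k + r - 2 * k = r by omega, poch_left]
    rw [show c + (k : ℂ) + 1 = c + 1 + k by ring]
    push_cast [Nat.succ_eq_add_one] at h1 h2 ⊢
    linear_combination (-(c + k) * poch (c + 1 + k) r) * (h1 + h2)

/-- Terminating balanced series identity with free parameter `b`
(first Hagen–Rothe proposition). -/
theorem hr_balanced_first (n : ℕ) (a b c : ℂ) (hb : b ≠ 1 / 2) (w : ℂ)
    (hw : w = (c + b * (n : ℂ)) / (1 - 2 * b))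
    (hcbn : c + b * (n : ℂ) ≠ 0)
    (hca : c + a ≠ 0)
    (hca' : c - a ≠ 0)
    (hc : ∀ j : ℕ, j ≤ max (n - 1) (n / 2) → c + (j : ℂ) ≠ 0)
    (hwj : ∀ j : ℕ, j < n / 2 → w + (j : ℂ) ≠ 0)
    (hcn : ∀ j : ℕ, j < n / 2 → 1 - c - (n : ℂ) + (j : ℂ) ≠ 0) :
    ∑ k ∈ Finset.range (n / 2 + 1),
      poch (-(n : ℂ) / 2) k * poch ((1 - (n : ℂ)) / 2) k * poch (1 + w) k *
        poch (-a) k * poch a k /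
        (poch (1 / 2) k * poch w k * poch (c + 1) k * poch (1 - c - (n : ℂ)) k *
          (Nat.factorial k : ℂ)) =
      (c * (c + a + b * (n : ℂ)) / (2 * (c + b * (n : ℂ)) * (a + c))) *
          (poch (c + a) n / poch c n) +
        (c * (c - a + b * (n : ℂ)) / (2 * (c + b * (n : ℂ)) * (c - a))) *
          (poch (c - a) n / poch c n) := by
  have hb' : 1 - 2 * b ≠ 0 := by
    intro h; apply hb; linear_combination -h / 2
  have hw0 : w ≠ 0 := by rw [hw]; exact div_ne_zero hcbn hb'
  have hwm : w * (1 - 2 * b) = c + b * n := by rw [hw]; exact div_mul_cancel₀ _ hb'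
  have hc0 : c ≠ 0 := by simpa using hc 0 (by omega)
  have hcN : poch c n ≠ 0 := by
    apply poch_ne; intro j hj; exact hc j (le_max_of_le_left (by omega))
  have hterm : ∀ k ∈ Finset.range (n / 2 + 1),
      poch (-(n : ℂ) / 2) k * poch ((1 - (n : ℂ)) / 2) k * poch (1 + w) k *
        poch (-a) k * poch a k /
        (poch (1 / 2) k * poch w k * poch (c + 1) k * poch (1 - c - (n : ℂ)) k *
          (Nat.factorial k : ℂ)) =
      c / ((c + b * n) * poch c n) * (cfac a k * tm c n k
        + b * (cfac a k * ((n - 2 * k) * tm c n k / (c + k)))) := by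
    intro k hk
    have hk' : k ≤ n / 2 := by simpa [Nat.lt_succ_iff] using hk
    have hck : c + (k : ℂ) ≠ 0 := hc k (le_max_of_le_right hk')
    have n1 : poch (1 / 2) k ≠ 0 := by
      apply poch_ne; intro j _ h
      have : ((1 + 2 * j : ℕ) : ℂ) = 0 := by push_cast; linear_combination 2 * h
      rw [Nat.cast_eq_zero] at this; omega
    have n2 : poch w k ≠ 0 := by
      apply poch_ne; intro j hj; exact hwj j (by omega)
    have n3 : poch (1 - c - (n : ℂ)) k ≠ 0 := by
      apply poch_ne; intro j hj; exact hcn j (by omega)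
    have n4 : poch c k ≠ 0 := by
      apply poch_ne; intro j hj; exact hc j (le_max_of_le_right (by omega))
    have n6 : (Nat.factorial k : ℂ) ≠ 0 := by exact_mod_cast Nat.factorial_ne_zero k
    have f1 := poch_shift c k
    rw [add_comm 1 c] at f1
    have n5 : poch (c + 1) k ≠ 0 := by
      intro h; rw [h, zero_mul] at f1
      exact mul_ne_zero n4 hck f1.symm
    have f2 := poch_refl c n k (by omega)
    have f3 := poch_add' c k (n - 2 * k)
    rw [show k + (n - 2 * k) = n - k by omega] at f3
    have f4 := half_poch n k
    have f5 := cfac_eq a k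
    have f6 : poch (1 + w) k = poch w k * (w + k) / w := by
      rw [eq_div_iff hw0]; exact poch_shift w k
    have f7 : poch (c + 1) k = poch c k * (c + k) / c := by
      rw [eq_div_iff hc0]; exact f1
    have hs : ((-1 : ℂ) ^ k) * (-1) ^ k = 1 := by rw [← mul_pow]; simp
    have hX : poch c k * poch (c + k) (n - 2 * k) * poch (1 - c - (n : ℂ)) k
        = (-1) ^ k * poch c n := by
      rw [← f2, f3]
      linear_combination (-poch c k * poch (c + k) (n - 2 * k) * poch (1 - c - (n : ℂ)) k) * hs
    have hX' : (-1) ^ k / poch (1 - c - (n : ℂ)) k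
        = poch c k * poch (c + k) (n - 2 * k) / poch c n := by
      rw [div_eq_div_iff n3 hcN, hX]
    have hW : (w + k) / w = (c + k + b * (n - 2 * k)) / (c + b * n) := by
      rw [div_eq_div_iff hw0 hcbn]; linear_combination (-(k : ℂ)) * hwm
    calc _ = (poch (-(n : ℂ) / 2) k * poch ((1 - (n : ℂ)) / 2) k) * poch (1 + w) k *
        (poch (-a) k * poch a k) /
        (poch (1 / 2) k * poch w k * poch (c + 1) k * poch (1 - c - (n : ℂ)) k *
          (Nat.factorial k : ℂ)) := by ring
      _ = n.choose (2 * k) * cfac a k * (c / (poch c k * (c + k))) * ((w + k) / w) *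
          ((-1) ^ k / poch (1 - c - (n : ℂ)) k) := by
        rw [f4, f5, f6, f7]; field_simp
      _ = _ := by
        rw [hX', hW, tm]; field_simp
  rw [Finset.sum_congr rfl hterm, ← Finset.mul_sum, Finset.sum_add_distrib, ← Finset.mul_sum,
    key a c n (n / 2) (by omega)]
  have hac : a + c ≠ 0 := by rwa [add_comm]
  rcases n with _ | m
  · simp [cfac, tm, poch] at hcbn ⊢
    field_simp
    ring
  · have h2 : ∑ k ∈ Finset.range ((m + 1) / 2 + 1),
        cfac a k * ((((m + 1 : ℕ) : ℂ) - 2 * k) * tm c (m + 1) k / (c + k)) =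
        (m + 1) * ((poch (c + 1 + a) m + poch (c + 1 - a) m) / 2) := by
      rw [← key a (c + 1) m ((m + 1) / 2) (by omega), Finset.mul_sum]
      apply Finset.sum_congr rfl
      intro k hk
      have hk' : k ≤ (m + 1) / 2 := by simpa [Nat.lt_succ_iff] using hk
      have hck : c + (k : ℂ) ≠ 0 := hc k (le_max_of_le_right hk')
      push_cast
      rw [tm_shift c m k (by omega)]
      field_simp
    rw [h2, poch_left (c + a), poch_left (c - a), show c + a + 1 = c + 1 + a by ring,
      show c - a + 1 = c + 1 - a by ring]
    push_cast at hcbn ⊢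
    field_simp
    ring
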